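/- Let n ≥ 1, let k be a real number with 2k > n, let C > 0, and let F : ℝⁿ → ℂ be measurable with |F(ξ)| ≤ C/(1 + |ξ|^k) for all ξ ∈ ℝⁿ. Then there exists a constant c > 0, depending only on n, k, and C, such that for all ε ∈ (0, 1]: ∫_{{ξ : |F(ξ)| ≤ 10ε}} |F(ξ)|² dξ ≤ c·ε^{2 − n/k}. -/

import Mathlib

open MeasureTheory Real
open scoped ENNReal

/-- If `y ≤ 10ε` and `y ≤ C / (1 + x ^ k)`, then `y` is bounded by a multiple of `ε` times the
rescaled weight `(1 + ε ^ (1 / k) * x) ^ (-k)`. -/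
lemma le_mul_one_add_rpow_neg_of_le {k C x y ε : ℝ} (hk : 0 < k) (hC : 0 < C) (hx : 0 ≤ x)
    (hy : 0 ≤ y) (hε : 0 < ε) (h₁ : y ≤ 10 * ε) (h₂ : y ≤ C / (1 + x ^ k)) :
    y ≤ ε * ((10 + C) * 2 ^ k) * (1 + ε ^ (1 / k) * x) ^ (-k) := by
  set t := ε ^ (1 / k) * x with ht
  have ht₀ : 0 ≤ t := by positivity
  have htk : t ^ k = ε * x ^ k := by
    rw [ht, mul_rpow (by positivity) hx, ← rpow_mul hε.le, one_div_mul_cancel hk.ne', rpow_one]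
  have hxk : 0 ≤ x ^ k := by positivity
  have h2k : (0 : ℝ) < 2 ^ k := by positivity
  rw [rpow_neg (by positivity), ← div_eq_mul_inv, le_div_iff₀ (by positivity)]
  rcases le_total t 1 with h | h
  · have h₃ : (1 + t) ^ k ≤ 2 ^ k := rpow_le_rpow (by positivity) (by linarith) hk.le
    calc y * (1 + t) ^ k ≤ (10 * ε) * 2 ^ k := by gcongr
      _ ≤ ε * ((10 + C) * 2 ^ k) := by nlinarith [mul_pos (mul_pos hε hC) h2k]
  · have h₃ : (1 + t) ^ k ≤ 2 ^ k * (ε * x ^ k) := by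
      rw [← htk, ← mul_rpow zero_le_two ht₀]
      exact rpow_le_rpow (by positivity) (by linarith) hk.le
    have h₄ : y * x ^ k ≤ C := by
      rw [le_div_iff₀ (by positivity)] at h₂
      nlinarith
    calc y * (1 + t) ^ k ≤ y * (2 ^ k * (ε * x ^ k)) := by gcongr
      _ = ε * (y * x ^ k * 2 ^ k) := by ring
      _ ≤ ε * ((10 + C) * 2 ^ k) := by gcongr; linarith

/-- **Lemma 2 (Steinerberger).** If `F : ℝⁿ → ℂ` is measurable with
`|F(ξ)| ≤ C/(1 + |ξ|^k)` where `2k > n`, then there is a constant `c > 0`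
depending only on `n, k, C` such that for all `0 < ε ≤ 1` one has
`∫_{|F| ≤ 10ε} |F|² ≤ c·ε^{2−n/k}`. -/
theorem small_fourier_tail_integral_bound
    (n : ℕ) (hn : 1 ≤ n) (k : ℝ) (hk : (n : ℝ) < 2 * k) (C : ℝ) (hC : 0 < C) :
    ∃ c : ℝ, 0 < c ∧ ∀ F : EuclideanSpace ℝ (Fin n) → ℂ, Measurable F →
      (∀ ξ, ‖F ξ‖ ≤ C / (1 + ‖ξ‖ ^ k)) →
      ∀ ε : ℝ, 0 < ε → ε ≤ 1 →
        ∫ ξ in {ξ | ‖F ξ‖ ≤ 10 * ε}, ‖F ξ‖ ^ 2 ≤ c * ε ^ (2 - (n : ℝ) / k) := by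
  have hk₀ : 0 < k := by
    have : (1 : ℝ) ≤ n := by exact_mod_cast hn
    linarith
  set M : ℝ := (10 + C) * 2 ^ k
  let w : EuclideanSpace ℝ (Fin n) → ℝ := fun x ↦ (1 + ‖x‖) ^ (-(2 * k))
  have hw : Integrable w := integrable_one_add_norm (by simpa using hk)
  have hw₀ : 0 ≤ ∫ x, w x := integral_nonneg fun x ↦ by positivity
  refine ⟨M ^ 2 * (∫ x, w x) + 1, by positivity, fun F hF hFC ε hε _ ↦ ?_⟩
  set a : ℝ := ε ^ (1 / k) with ha
  have ha₀ : 0 < a := by positivity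
  have hint : Integrable fun x ↦ (ε * M) ^ 2 * w (a • x) :=
    (hw.comp_smul ha₀.ne').const_mul _
  have hmeas : MeasurableSet {ξ | ‖F ξ‖ ≤ 10 * ε} :=
    measurableSet_le hF.norm measurable_const
  have hpt : ∀ ξ ∈ {ξ | ‖F ξ‖ ≤ 10 * ε}, ‖F ξ‖ ^ 2 ≤ (ε * M) ^ 2 * w (a • ξ) := by
    intro ξ hξ
    have h := le_mul_one_add_rpow_neg_of_le hk₀ hC (norm_nonneg ξ) (norm_nonneg (F ξ)) hε hξ
      (hFC ξ)
    have hsq : w (a • ξ) = ((1 + a * ‖ξ‖) ^ (-k)) ^ 2 := by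
      simp only [w, norm_smul, norm_of_nonneg ha₀.le]
      rw [← rpow_mul_natCast (by positivity)]
      congr 1
      push_cast
      ring
    rw [hsq, ← mul_pow]
    exact pow_le_pow_left₀ (norm_nonneg _) h 2
  have hscale : ε ^ 2 * (a ^ n)⁻¹ = ε ^ (2 - (n : ℝ) / k) := by
    rw [ha, ← rpow_mul_natCast hε.le, rpow_sub hε, rpow_two, one_div_mul_eq_div,
      div_eq_mul_inv (ε ^ 2)]
  calc ∫ ξ in {ξ | ‖F ξ‖ ≤ 10 * ε}, ‖F ξ‖ ^ 2
      ≤ ∫ ξ in {ξ | ‖F ξ‖ ≤ 10 * ε}, (ε * M) ^ 2 * w (a • ξ) :=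
        integral_mono_of_nonneg (.of_forall fun ξ ↦ by positivity) hint.integrableOn
          (ae_restrict_of_forall_mem hmeas hpt)
    _ ≤ ∫ ξ, (ε * M) ^ 2 * w (a • ξ) :=
        setIntegral_le_integral hint (.of_forall fun ξ ↦ by positivity)
    _ = M ^ 2 * (∫ x, w x) * ε ^ (2 - (n : ℝ) / k) := by
        rw [integral_const_mul, Measure.integral_comp_smul, finrank_euclideanSpace_fin,
          abs_of_pos (by positivity), smul_eq_mul, ← hscale]
        ring
    _ ≤ (M ^ 2 * (∫ x, w x) + 1) * ε ^ (2 - (n : ℝ) / k) := by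
        gcongr
        linarith
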